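/- Assume in addition that φ(0, ε𝟙) < ∞ for the starting value ε of the recursion. Then for every (η_0, η_1) ∈ ℝ² with η_0 < a_∞ = lim_{ℓ→∞} a_ℓ and η_1 < t_∞ = lim_{ℓ→∞} t_ℓ, one has φ(η_0, η_1𝟙) < ∞. -/

import Mathlib

open Filter Topology
open scoped ENNReal

noncomputable section

/-- Traffic intensity ρ = λ / Σ μᵢ. -/
def rho (k : ℕ) (lam : ℝ) (μ : Fin k → ℝ) : ℝ := lam / ∑ i, μ i

/-- Index set of the shortest queues: the zero coordinates of the difference vector. -/
def zeroSet (k : ℕ) (y : Fin k → ℕ) : Finset (Fin k) :=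
  Finset.univ.filter (fun i => y i = 0)

/-- One-step transition probability of the uniformized JSQ chain `Z = (M, Y)` on
`ℕ × (Fin k → ℕ)`, where `M` is the minimum queue length and `Y` the vector of
differences from the minimum. -/
def jsqP (k : ℕ) (lam : ℝ) (μ : Fin k → ℝ) (s s' : ℕ × (Fin k → ℕ)) : ℝ :=
  (if (zeroSet k s.2).card = 1 then
      (if s' = (s.1 + 1, fun j => s.2 j - 1) then lam else 0)
    else
      ∑ i ∈ zeroSet k s.2,
        (if s' = (s.1, Function.update s.2 i 1) then lam / (zeroSet k s.2).card else 0))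
  + (∑ j ∈ (zeroSet k s.2)ᶜ,
      (if s' = (s.1, Function.update s.2 j (s.2 j - 1)) then μ j else 0))
  + (∑ i ∈ zeroSet k s.2,
      (if s' = (if s.1 = 0 then s else (s.1 - 1, fun j => if j = i then 0 else s.2 j + 1))
        then μ i else 0))

/-- The exponential weight `e^{θ·Z}` for `θ ∈ ℝ^{k+1}` and a state `Z = (m, y)`. -/
def expWeight (k : ℕ) (θ : Fin (k + 1) → ℝ) (s : ℕ × (Fin k → ℕ)) : ℝ :=
  Real.exp (θ 0 * (s.1 : ℝ) + ∑ i : Fin k, θ i.succ * (s.2 i : ℝ))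

/-- The stationary moment generating function `φ(θ) = E[e^{θ·Z}] ∈ [0,∞]`. -/
def phi (k : ℕ) (π : ℕ × (Fin k → ℕ) → ℝ) (θ : Fin (k + 1) → ℝ) : ℝ≥0∞ :=
  ∑' s : ℕ × (Fin k → ℕ), ENNReal.ofReal (π s * expWeight k θ s)

/-- `φ_{+U}(θ) = E[e^{θ·Z} 1(Z ∈ S_{+U})]`. -/
def phiPlus (k : ℕ) (π : ℕ × (Fin k → ℕ) → ℝ) (U : Finset (Fin k))
    (θ : Fin (k + 1) → ℝ) : ℝ≥0∞ :=
  ∑' s : ℕ × (Fin k → ℕ),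
    if 1 ≤ s.1 ∧ zeroSet k s.2 = U then ENNReal.ofReal (π s * expWeight k θ s) else 0

/-- `φ_{0U}(θ) = E[e^{θ·Z} 1(Z ∈ S_{0U})]`. -/
def phiZero (k : ℕ) (π : ℕ × (Fin k → ℕ) → ℝ) (U : Finset (Fin k))
    (θ : Fin (k + 1) → ℝ) : ℝ≥0∞ :=
  ∑' s : ℕ × (Fin k → ℕ),
    if s.1 = 0 ∧ zeroSet k s.2 = U then ENNReal.ofReal (π s * expWeight k θ s) else 0

/-- The mgf `γ_{+U}(θ)` of the one-step increment from states in `S_{+U}`. -/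
def gammaPlus (k : ℕ) (lam : ℝ) (μ : Fin k → ℝ) (U : Finset (Fin k))
    (θ : Fin (k + 1) → ℝ) : ℝ :=
  (if U.card = 1 then lam * Real.exp (θ 0 - ∑ j ∈ Uᶜ, θ j.succ)
    else ∑ i ∈ U, (lam / U.card) * Real.exp (θ i.succ))
  + ∑ j ∈ Uᶜ, μ j * Real.exp (-θ j.succ)
  + ∑ i ∈ U, μ i * Real.exp (-θ 0 + ∑ j ∈ Finset.univ.erase i, θ j.succ)

/-- The mgf `γ_{0U}(θ)` of the one-step increment from states in `S_{0U}`. -/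
def gammaZero (k : ℕ) (lam : ℝ) (μ : Fin k → ℝ) (U : Finset (Fin k))
    (θ : Fin (k + 1) → ℝ) : ℝ :=
  (if U.card = 1 then lam * Real.exp (θ 0 - ∑ j ∈ Uᶜ, θ j.succ)
    else ∑ i ∈ U, (lam / U.card) * Real.exp (θ i.succ))
  + ∑ j ∈ Uᶜ, μ j * Real.exp (-θ j.succ)
  + ∑ i ∈ U, μ i

end


noncomputable section

/-- The two-dimensional marginal mgf `γ^{(2)}_{+U}(η₀, η₁) = γ_{+U}(η₀, η₁𝟙)`. -/
def gamma2 (k : ℕ) (lam : ℝ) (μ : Fin k → ℝ) (U : Finset (Fin k)) (η₀ η₁ : ℝ) : ℝ :=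
  (if U.card = 1 then lam * Real.exp (η₀ - ((k : ℝ) - 1) * η₁) else lam * Real.exp η₁)
  + (∑ j ∈ Uᶜ, μ j) * Real.exp (-η₁)
  + (∑ i ∈ U, μ i) * Real.exp (-η₀ + ((k : ℝ) - 1) * η₁)

end


/-- A Foster–Lyapunov criterion: if `f` contracts in mean under a stationary kernel outside `B`, is
multiplied by at most `C` in mean on `B`, and is integrable on `B`, then it is integrable. -/
theorem tsum_mul_ne_top_of_drift {S : Type*} (p : S → ℝ≥0∞) (K : S → S → ℝ≥0∞)
    (hp : ∑' s, p s ≠ ⊤) (hstat : ∀ s', ∑' s, p s * K s s' = p s')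
    (hK : ∀ s, p s ≠ 0 → ∑' s', K s s' ≤ 1) (f : S → ℝ≥0∞) (hf : ∀ s, f s ≠ ⊤)
    (B : Set S) (r C : ℝ≥0∞) (hr : r < 1) (hC : C ≠ ⊤)
    (hgood : ∀ s, p s ≠ 0 → s ∉ B → ∑' s', K s s' * f s' ≤ r * f s)
    (hbad : ∀ s, p s ≠ 0 → s ∈ B → ∑' s', K s s' * f s' ≤ C * f s)
    (hB : ∑' s, B.indicator (fun s => p s * f s) s ≠ ⊤) :
    ∑' s, p s * f s ≠ ⊤ := by
  classical
  set β := ∑' s, B.indicator (fun s => p s * f s) s with hβ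
  have key : ∀ T : Finset S,
      ∑ s ∈ T, (1 - r) * Bᶜ.indicator (fun s => p s * f s) s ≤ C * β := by
    intro T
    set n : ℝ≥0∞ := ∑ s ∈ T, f s
    have hntop : n ≠ ⊤ := ENNReal.sum_ne_top.2 fun s _ => hf s
    set g : S → ℝ≥0∞ := fun s => min (f s) n
    set h : S → ℝ≥0∞ := fun s => min (∑' s', K s s' * f s') n
    have hgh : ∑' s, p s * g s ≤ ∑' s, p s * h s := by
      calc ∑' s', p s' * g s' = ∑' s', ∑' s, p s * (K s s' * g s') := by
            refine tsum_congr fun s' => ?_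
            rw [← hstat s', ← ENNReal.tsum_mul_right]
            exact tsum_congr fun s => mul_assoc _ _ _
        _ = ∑' s, ∑' s', p s * (K s s' * g s') := ENNReal.tsum_comm
        _ = ∑' s, p s * ∑' s', K s s' * g s' :=
            tsum_congr fun s => ENNReal.tsum_mul_left
        _ ≤ ∑' s, p s * h s := by
            refine ENNReal.tsum_le_tsum fun s => ?_
            by_cases hs : p s = 0
            · simp [hs]
            refine mul_le_mul_right (le_min ?_ ?_) _
            · exact ENNReal.tsum_le_tsum fun s' => mul_le_mul_right (min_le_left _ _) _
            · calc ∑' s', K s s' * g s' ≤ ∑' s', K s s' * n :=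
                    ENNReal.tsum_le_tsum fun s' => mul_le_mul_right (min_le_right _ _) _
                _ = (∑' s', K s s') * n := ENNReal.tsum_mul_right
                _ ≤ 1 * n := mul_le_mul_left (hK s hs) _
                _ = n := one_mul n
    have hhtop : ∑' s, p s * h s ≠ ⊤ := by
      refine ne_top_of_le_ne_top (ENNReal.mul_ne_top hp hntop) ?_
      rw [← ENNReal.tsum_mul_right]
      exact ENNReal.tsum_le_tsum fun s => mul_le_mul_right (min_le_right _ _) _
    have hpt : ∀ s, p s * h s +
        (T : Set S).indicator (fun s => (1 - r) * Bᶜ.indicator (fun s => p s * f s) s) s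
        ≤ p s * g s + C * B.indicator (fun s => p s * f s) s := by
      intro s
      by_cases hs : p s = 0
      · simp [hs, Set.indicator_apply]
      by_cases hsB : s ∈ B
      · have h1 : h s ≤ C * f s := (min_le_left _ _).trans (hbad s hs hsB)
        simp only [Set.indicator_apply, Set.mem_compl_iff, hsB, not_true, if_false, mul_zero,
          ite_self, add_zero, if_true]
        calc p s * h s ≤ p s * (C * f s) := mul_le_mul_right h1 _
          _ = C * (p s * f s) := by ring
          _ ≤ _ := le_add_self
      · have h1 := hgood s hs hsB
        have hrf : r * f s ≤ f s := by
          simpa using mul_le_mul_left hr.le (f s)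
        by_cases hsT : s ∈ T
        · have hfn : f s ≤ n := Finset.single_le_sum (f := f) (fun _ _ => zero_le) hsT
          simp only [Set.indicator_apply, Set.mem_compl_iff, hsB, not_false_iff, if_true,
            if_false, Finset.mem_coe, hsT, mul_zero, add_zero]
          have h2 : g s = f s := min_eq_left hfn
          rw [h2]
          calc p s * h s + (1 - r) * (p s * f s)
              ≤ p s * (r * f s) + (1 - r) * (p s * f s) := by
                gcongr
                exact (min_le_left _ _).trans h1
            _ = (r + (1 - r)) * (p s * f s) := by ring
            _ = p s * f s := by rw [add_tsub_cancel_of_le hr.le, one_mul]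
        · simp only [Set.indicator_apply, Set.mem_compl_iff, hsB, if_false, Finset.mem_coe, hsT,
            mul_zero, add_zero]
          exact mul_le_mul_right (min_le_min_right _ (h1.trans hrf)) _
    have hsum := ENNReal.tsum_le_tsum hpt
    rw [ENNReal.tsum_add, ENNReal.tsum_add, ENNReal.tsum_mul_left, ← hβ,
      ← sum_eq_tsum_indicator] at hsum
    exact (ENNReal.add_le_add_iff_left hhtop).1 (hsum.trans (by gcongr))
  have hgoodsum : ∑' s, (1 - r) * Bᶜ.indicator (fun s => p s * f s) s ≤ C * β := by
    rw [ENNReal.tsum_eq_iSup_sum]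
    exact iSup_le key
  rw [ENNReal.tsum_mul_left] at hgoodsum
  have hgood' : ∑' s, Bᶜ.indicator (fun s => p s * f s) s ≠ ⊤ := by
    intro htop
    have h1r : 1 - r ≠ 0 := (tsub_pos_of_lt hr).ne'
    rw [htop, ENNReal.mul_top h1r] at hgoodsum
    exact ENNReal.mul_ne_top hC hB (top_le_iff.1 hgoodsum)
  have hsplit : ∑' s, p s * f s = β + ∑' s, Bᶜ.indicator (fun s => p s * f s) s := by
    rw [hβ, ← ENNReal.tsum_add]
    exact tsum_congr fun s =>
      (congrFun (Set.indicator_self_add_compl B fun s => p s * f s) s).symm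
  rw [hsplit]
  exact ENNReal.add_ne_top.2 ⟨hB, hgood'⟩

noncomputable section

/-- The mean of `f` after one step of the chain started at `s`. -/
def jsqMean (k : ℕ) (lam : ℝ) (μ : Fin k → ℝ) (f : ℕ × (Fin k → ℕ) → ℝ)
    (s : ℕ × (Fin k → ℕ)) : ℝ :=
  (if (zeroSet k s.2).card = 1 then lam * f (s.1 + 1, fun j => s.2 j - 1)
    else ∑ i ∈ zeroSet k s.2,
      lam / (zeroSet k s.2).card * f (s.1, Function.update s.2 i 1))
  + (∑ j ∈ (zeroSet k s.2)ᶜ, μ j * f (s.1, Function.update s.2 j (s.2 j - 1)))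
  + (∑ i ∈ zeroSet k s.2,
      μ i * f (if s.1 = 0 then s else (s.1 - 1, fun j => if j = i then 0 else s.2 j + 1)))

end

theorem hasSum_ite_eq_mul {S : Type*} [DecidableEq S] (x : S) (c : ℝ) (f : S → ℝ) :
    HasSum (fun s => (if s = x then c else 0) * f s) (c * f x) := by
  have h : (fun s => (if s = x then c else 0) * f s) = fun s => if s = x then c * f x else 0 := by
    funext s
    split_ifs with h
    · rw [h]
    · simp
  rw [h]
  exact hasSum_ite_eq x _

theorem hasSum_jsqP_mul (k : ℕ) (lam : ℝ) (μ : Fin k → ℝ) (f : ℕ × (Fin k → ℕ) → ℝ)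
    (s : ℕ × (Fin k → ℕ)) :
    HasSum (fun s' => jsqP k lam μ s s' * f s') (jsqMean k lam μ f s) := by
  simp only [jsqP, jsqMean, add_mul]
  refine HasSum.add (HasSum.add ?_ ?_) ?_
  · split_ifs
    · exact hasSum_ite_eq_mul _ _ _
    · simp only [Finset.sum_mul]
      exact hasSum_sum fun i _ => hasSum_ite_eq_mul _ _ _
  · simp only [Finset.sum_mul]
    exact hasSum_sum fun i _ => hasSum_ite_eq_mul _ _ _
  · simp only [Finset.sum_mul]
    exact hasSum_sum fun i _ => hasSum_ite_eq_mul _ _ _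

theorem jsqP_nonneg {k : ℕ} {lam : ℝ} {μ : Fin k → ℝ} (hlam : 0 < lam) (hμ : ∀ i, 0 < μ i)
    (s s' : ℕ × (Fin k → ℕ)) : 0 ≤ jsqP k lam μ s s' := by
  unfold jsqP
  refine add_nonneg (add_nonneg ?_ ?_) ?_
  · split_ifs
    · exact hlam.le
    · exact le_rfl
    · exact Finset.sum_nonneg fun i _ => by split_ifs <;> positivity
  · exact Finset.sum_nonneg fun i _ => by split_ifs <;> first | exact (hμ i).le | exact le_rfl
  · exact Finset.sum_nonneg fun i _ => by
      by_cases h : s' = if s.1 = 0 then s else (s.1 - 1, fun j => if j = i then 0 else s.2 j + 1)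
      · rw [if_pos h]; exact (hμ i).le
      · rw [if_neg h]

theorem tsum_ofReal_jsqP_mul {k : ℕ} {lam : ℝ} {μ : Fin k → ℝ} (hlam : 0 < lam)
    (hμ : ∀ i, 0 < μ i) (f : ℕ × (Fin k → ℕ) → ℝ) (hf : ∀ s, 0 ≤ f s)
    (s : ℕ × (Fin k → ℕ)) :
    ∑' s', ENNReal.ofReal (jsqP k lam μ s s') * ENNReal.ofReal (f s')
      = ENNReal.ofReal (jsqMean k lam μ f s) := by
  have h := hasSum_jsqP_mul k lam μ f s
  rw [← h.tsum_eq, ENNReal.ofReal_tsum_of_nonneg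
    (fun s' => mul_nonneg (jsqP_nonneg hlam hμ s s') (hf s')) h.summable]
  exact tsum_congr fun s' => (ENNReal.ofReal_mul (jsqP_nonneg hlam hμ s s')).symm

theorem mem_zeroSet {k : ℕ} {y : Fin k → ℕ} {i : Fin k} : i ∈ zeroSet k y ↔ y i = 0 := by
  simp [zeroSet]

theorem lam_join_le {lam : ℝ} (hlam : 0 < lam) (n : ℕ) : (n : ℝ) * (lam / n) ≤ lam := by
  rcases Nat.eq_zero_or_pos n with h | h
  · simp [h, hlam.le]
  · have : (n : ℝ) ≠ 0 := by positivity
    exact (mul_div_cancel₀ lam this).le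

/-- If no transition out of `s` takes `f` above `b`, and serving a non-shortest queue `j` takes
it at most to `c j`, the mean after one step is bounded accordingly. -/
theorem jsqMean_le {k : ℕ} {lam : ℝ} {μ : Fin k → ℝ} (hlam : 0 < lam) (hμ : ∀ i, 0 < μ i)
    (hnorm : lam + ∑ i, μ i = 1) (f : ℕ × (Fin k → ℕ) → ℝ) (s : ℕ × (Fin k → ℕ))
    (b : ℝ) (hb : 0 ≤ b) (c : Fin k → ℝ)
    (h₁ : (zeroSet k s.2).card = 1 → f (s.1 + 1, fun j => s.2 j - 1) ≤ b)
    (h₂ : ∀ i, s.2 i = 0 → f (s.1, Function.update s.2 i 1) ≤ b)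
    (h₃ : ∀ j, s.2 j ≠ 0 → f (s.1, Function.update s.2 j (s.2 j - 1)) ≤ c j)
    (h₄ : ∀ i, s.2 i = 0 →
      f (if s.1 = 0 then s else (s.1 - 1, fun j => if j = i then 0 else s.2 j + 1)) ≤ b) :
    jsqMean k lam μ f s ≤ b - ∑ j ∈ (zeroSet k s.2)ᶜ, μ j * (b - c j) := by
  have e₁ : (if (zeroSet k s.2).card = 1 then lam * f (s.1 + 1, fun j => s.2 j - 1)
    else ∑ i ∈ zeroSet k s.2,
      lam / (zeroSet k s.2).card * f (s.1, Function.update s.2 i 1)) ≤ lam * b := by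
    split_ifs with h
    · exact mul_le_mul_of_nonneg_left (h₁ h) hlam.le
    · calc _ ≤ ∑ i ∈ zeroSet k s.2, lam / (zeroSet k s.2).card * b :=
            Finset.sum_le_sum fun i hi =>
              mul_le_mul_of_nonneg_left (h₂ i (mem_zeroSet.1 hi)) (by positivity)
        _ = ((zeroSet k s.2).card * (lam / (zeroSet k s.2).card)) * b := by
            rw [Finset.sum_const, nsmul_eq_mul]; ring
        _ ≤ lam * b := mul_le_mul_of_nonneg_right (lam_join_le hlam _) hb
  have e₂ : ∑ j ∈ (zeroSet k s.2)ᶜ, μ j * f (s.1, Function.update s.2 j (s.2 j - 1))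
      ≤ (∑ j ∈ (zeroSet k s.2)ᶜ, μ j) * b - ∑ j ∈ (zeroSet k s.2)ᶜ, μ j * (b - c j) := by
    rw [Finset.sum_mul, ← Finset.sum_sub_distrib]
    refine Finset.sum_le_sum fun j hj => ?_
    have := mul_le_mul_of_nonneg_left
      (h₃ j fun h => Finset.mem_compl.1 hj (mem_zeroSet.2 h)) (hμ j).le
    linarith
  have e₃ : ∑ i ∈ zeroSet k s.2,
      μ i * f (if s.1 = 0 then s else (s.1 - 1, fun j => if j = i then 0 else s.2 j + 1))
      ≤ (∑ i ∈ zeroSet k s.2, μ i) * b := by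
    rw [Finset.sum_mul]
    exact Finset.sum_le_sum fun i hi =>
      mul_le_mul_of_nonneg_left (h₄ i (mem_zeroSet.1 hi)) (hμ i).le
  have e₄ : (lam + (∑ i ∈ zeroSet k s.2, μ i + ∑ j ∈ (zeroSet k s.2)ᶜ, μ j)) * b = b := by
    rw [Finset.sum_add_sum_compl, hnorm, one_mul]
  unfold jsqMean
  linarith

theorem tsum_ofReal_jsqP_le_one {k : ℕ} {lam : ℝ} {μ : Fin k → ℝ} (hlam : 0 < lam)
    (hμ : ∀ i, 0 < μ i) (hnorm : lam + ∑ i, μ i = 1) (s : ℕ × (Fin k → ℕ)) :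
    ∑' s', ENNReal.ofReal (jsqP k lam μ s s') ≤ 1 := by
  have h := tsum_ofReal_jsqP_mul hlam hμ (fun _ => 1) (fun _ => zero_le_one) s
  simp only [ENNReal.ofReal_one, mul_one] at h
  rw [h, ENNReal.ofReal_le_one]
  refine (jsqMean_le hlam hμ hnorm (fun _ => 1) s 1 zero_le_one (fun _ => 1) ?_ ?_ ?_ ?_).trans ?_
  all_goals simp

theorem tsum_ofReal_mul_jsqP {k : ℕ} {lam : ℝ} {μ : Fin k → ℝ} (hlam : 0 < lam)
    (hμ : ∀ i, 0 < μ i) (hnorm : lam + ∑ i, μ i = 1) {π : ℕ × (Fin k → ℕ) → ℝ}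
    (hπnn : ∀ s, 0 ≤ π s) (hπsum : HasSum π 1)
    (hπstat : ∀ s', (∑' s, π s * jsqP k lam μ s s') = π s') (s' : ℕ × (Fin k → ℕ)) :
    ∑' s, ENNReal.ofReal (π s) * ENNReal.ofReal (jsqP k lam μ s s') = ENNReal.ofReal (π s') := by
  have hle : ∀ s, jsqP k lam μ s s' ≤ 1 := fun s => by
    have := (ENNReal.le_tsum s').trans (tsum_ofReal_jsqP_le_one hlam hμ hnorm s)
    exact ENNReal.ofReal_le_one.1 this
  have hnn : ∀ s, 0 ≤ π s * jsqP k lam μ s s' := fun s =>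
    mul_nonneg (hπnn s) (jsqP_nonneg hlam hμ s s')
  have hsm : Summable fun s => π s * jsqP k lam μ s s' :=
    Summable.of_nonneg_of_le hnn (fun s => mul_le_of_le_one_right (hπnn s) (hle s))
      hπsum.summable
  rw [← hπstat s', ENNReal.ofReal_tsum_of_nonneg hnn hsm]
  exact tsum_congr fun s => (ENNReal.ofReal_mul (hπnn s)).symm

/-- The Foster–Lyapunov criterion for the join-the-shortest-queue chain. -/
theorem jsq_tsum_ne_top_of_drift {k : ℕ} {lam : ℝ} {μ : Fin k → ℝ} (hlam : 0 < lam)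
    (hμ : ∀ i, 0 < μ i) (hnorm : lam + ∑ i, μ i = 1) {π : ℕ × (Fin k → ℕ) → ℝ}
    (hπnn : ∀ s, 0 ≤ π s) (hπsupp : ∀ s, π s ≠ 0 → ∃ i : Fin k, s.2 i = 0)
    (hπsum : HasSum π 1)
    (hπstat : ∀ s', (∑' s, π s * jsqP k lam μ s s') = π s')
    (f : ℕ × (Fin k → ℕ) → ℝ) (hf : ∀ s, 0 ≤ f s) (B : Set (ℕ × (Fin k → ℕ))) (r C : ℝ)
    (hr : r < 1)
    (hgood : ∀ s, (∃ i : Fin k, s.2 i = 0) → s ∉ B → jsqMean k lam μ f s ≤ r * f s)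
    (hbad : ∀ s, (∃ i : Fin k, s.2 i = 0) → s ∈ B → jsqMean k lam μ f s ≤ C * f s)
    (hB : ∑' s, B.indicator (fun s => ENNReal.ofReal (π s * f s)) s ≠ ⊤) :
    ∑' s, ENNReal.ofReal (π s * f s) ≠ ⊤ := by
  have hsupp : ∀ s, ENNReal.ofReal (π s) ≠ 0 → ∃ i : Fin k, s.2 i = 0 := fun s hs =>
    hπsupp s fun h => hs (by simp [h])
  simp only [fun s => ENNReal.ofReal_mul (q := f s) (hπnn s)] at hB ⊢
  refine tsum_mul_ne_top_of_drift (fun s => ENNReal.ofReal (π s))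
    (fun s s' => ENNReal.ofReal (jsqP k lam μ s s')) ?_
    (tsum_ofReal_mul_jsqP hlam hμ hnorm hπnn hπsum hπstat)
    (fun s _ => tsum_ofReal_jsqP_le_one hlam hμ hnorm s)
    (fun s => ENNReal.ofReal (f s)) (fun s => ENNReal.ofReal_ne_top) B
    (ENNReal.ofReal r) (ENNReal.ofReal C) (by simpa using hr) ENNReal.ofReal_ne_top ?_ ?_ hB
  · rw [← ENNReal.ofReal_tsum_of_nonneg hπnn hπsum.summable]
    exact ENNReal.ofReal_ne_top
  · intro s hs hsB
    rw [tsum_ofReal_jsqP_mul hlam hμ f hf, ← ENNReal.ofReal_mul' (hf s)]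
    exact ENNReal.ofReal_le_ofReal (hgood s (hsupp s hs) hsB)
  · intro s hs hsB
    rw [tsum_ofReal_jsqP_mul hlam hμ f hf, ← ENNReal.ofReal_mul' (hf s)]
    exact ENNReal.ofReal_le_ofReal (hbad s (hsupp s hs) hsB)

/-- If the minimum queue length has a finite exponential moment of order `η > 0`, so has the
length of every queue. -/
theorem jsq_queue_moment_ne_top {k : ℕ} {lam : ℝ} {μ : Fin k → ℝ} (hlam : 0 < lam)
    (hμ : ∀ i, 0 < μ i) (hnorm : lam + ∑ i, μ i = 1) {π : ℕ × (Fin k → ℕ) → ℝ}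
    (hπnn : ∀ s, 0 ≤ π s) (hπsupp : ∀ s, π s ≠ 0 → ∃ i : Fin k, s.2 i = 0)
    (hπsum : HasSum π 1)
    (hπstat : ∀ s', (∑' s, π s * jsqP k lam μ s s') = π s')
    (η : ℝ) (hη : 0 < η)
    (hmin : ∑' s : ℕ × (Fin k → ℕ), ENNReal.ofReal (π s * Real.exp (η * s.1)) ≠ ⊤)
    (j : Fin k) :
    ∑' s : ℕ × (Fin k → ℕ), ENNReal.ofReal (π s * Real.exp (η * (s.1 + s.2 j : ℕ))) ≠ ⊤ := by
  have hexp : ∀ n m : ℕ, n ≤ m → Real.exp (η * n) ≤ Real.exp (η * m) := fun n m h => by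
    gcongr
  have hsucc : ∀ n : ℕ, Real.exp (η * (n + 1 : ℕ)) = Real.exp η * Real.exp (η * n) := fun n => by
    rw [← Real.exp_add]; push_cast; ring_nf
  have h1 : Real.exp (-η) < 1 := Real.exp_lt_one_iff.mpr (by linarith)
  refine jsq_tsum_ne_top_of_drift hlam hμ hnorm hπnn hπsupp hπsum hπstat
    (fun s => Real.exp (η * (s.1 + s.2 j : ℕ))) (fun s => (Real.exp_pos _).le) {s | s.2 j = 0}
    (1 - μ j * (1 - Real.exp (-η))) (Real.exp η) ?_ ?_ ?_ ?_
  · have := mul_pos (hμ j) (sub_pos.2 h1)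
    linarith
  · rintro ⟨m, y⟩ - hj
    have hj : y j ≠ 0 := hj
    refine (jsqMean_le hlam hμ hnorm _ (m, y) (Real.exp (η * (m + y j : ℕ)))
      (Real.exp_pos _).le
      (fun i => if i = j then Real.exp (-η) * Real.exp (η * (m + y j : ℕ))
        else Real.exp (η * (m + y j : ℕ))) ?_ ?_ ?_ ?_).trans ?_
    · intro _
      exact hexp _ _ (by simp only; omega)
    · intro i hi
      have hi : y i = 0 := hi
      have hij : j ≠ i := fun h => hj (h ▸ hi)
      exact hexp _ _ (by simp [Function.update_of_ne hij])
    · intro i _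
      by_cases hij : i = j
      · subst hij
        simp only [Function.update_self, if_true]
        rw [← Real.exp_add]
        refine Real.exp_le_exp.2 (le_of_eq ?_)
        have : m + y i = (m + (y i - 1)) + 1 := by omega
        rw [this]
        push_cast
        ring
      · simp only [if_neg hij]
        exact hexp _ _ (by simp [Function.update_of_ne (Ne.symm hij)])
    · intro i hi
      have hi : y i = 0 := hi
      have hij : j ≠ i := fun h => hj (h ▸ hi)
      refine hexp _ _ ?_
      by_cases hm : m = 0
      · simp [hm]
      · simp only [hm, hij, if_false]
        omega
    · rw [Finset.sum_eq_single_of_mem j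
        (Finset.mem_compl.2 fun h => hj (mem_zeroSet.1 h))
        (fun i _ hi => by simp [hi])]
      simp only [if_true]
      exact le_of_eq (by ring)
  · rintro ⟨m, y⟩ - hj
    have hj : y j = 0 := hj
    simp only [hj, add_zero]
    rw [← hsucc]
    refine (jsqMean_le hlam hμ hnorm _ (m, y) (Real.exp (η * (m + 1 : ℕ)))
      (Real.exp_pos _).le (fun _ => Real.exp (η * (m + 1 : ℕ))) ?_ ?_ ?_ ?_).trans ?_
    · intro _
      exact hexp _ _ (by simp only; omega)
    · intro i _
      refine hexp _ _ ?_
      by_cases hij : j = i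
      · subst hij; simp
      · simp [Function.update_of_ne hij, hj]
    · intro i hi
      have hi : y i ≠ 0 := hi
      have hij : j ≠ i := fun h => hi (h ▸ hj)
      exact hexp _ _ (by simp [Function.update_of_ne hij, hj])
    · intro i _
      refine hexp _ _ ?_
      by_cases hm : m = 0
      · simp [hm, hj]
      · simp only [hm, if_false]
        split_ifs <;> omega
    · simp
  · refine ne_top_of_le_ne_top hmin (ENNReal.tsum_le_tsum fun s => ?_)
    by_cases hs : s.2 j = 0 <;> simp [hs]

theorem phi_cons (k : ℕ) (π : ℕ × (Fin k → ℕ) → ℝ) (η₀ η₁ : ℝ) :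
    phi k π (Fin.cons η₀ (fun _ => η₁))
      = ∑' s : ℕ × (Fin k → ℕ),
          ENNReal.ofReal (π s * Real.exp (η₀ * s.1 + η₁ * ∑ i, (s.2 i : ℝ))) := by
  simp [phi, expWeight, Finset.mul_sum]

theorem phi_cons_mono {k : ℕ} {π : ℕ × (Fin k → ℕ) → ℝ} (hπnn : ∀ s, 0 ≤ π s)
    {η₀ η₁ ζ₀ ζ₁ : ℝ} (h₀ : η₀ ≤ ζ₀) (h₁ : η₁ ≤ ζ₁) :
    phi k π (Fin.cons η₀ (fun _ => η₁)) ≤ phi k π (Fin.cons ζ₀ (fun _ => ζ₁)) := by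
  rw [phi_cons, phi_cons]
  refine ENNReal.tsum_le_tsum fun s => ENNReal.ofReal_le_ofReal ?_
  refine mul_le_mul_of_nonneg_left (Real.exp_le_exp.2 ?_) (hπnn s)
  have : (0 : ℝ) ≤ ∑ i, (s.2 i : ℝ) := Finset.sum_nonneg fun _ _ => Nat.cast_nonneg _
  gcongr

theorem sum_update_natCast {k : ℕ} (y : Fin k → ℕ) (i : Fin k) (n : ℕ) :
    ∑ j, (Function.update y i n j : ℝ) = ∑ j, (y j : ℝ) - y i + n := by
  rw [← Finset.add_sum_erase _ _ (Finset.mem_univ i),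
    ← Finset.add_sum_erase _ (fun j => (y j : ℝ)) (Finset.mem_univ i), Function.update_self]
  have : ∑ j ∈ Finset.univ.erase i, (Function.update y i n j : ℝ)
      = ∑ j ∈ Finset.univ.erase i, (y j : ℝ) :=
    Finset.sum_congr rfl fun j hj => by rw [Function.update_of_ne (Finset.ne_of_mem_erase hj)]
  rw [this]
  ring

/-- The marginal exponential function is multiplied in mean by an explicit factor, which is
`gamma2` away from `{M = 0}`. -/
theorem jsqMean_exp {k : ℕ} {lam : ℝ} {μ : Fin k → ℝ} (η₀ η₁ : ℝ) (m : ℕ)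
    (y : Fin k → ℕ) (hy : ∃ i, y i = 0) :
    jsqMean k lam μ (fun s => Real.exp (η₀ * s.1 + η₁ * ∑ i, (s.2 i : ℝ))) (m, y)
      = ((if (zeroSet k y).card = 1 then lam * Real.exp (η₀ - ((k : ℝ) - 1) * η₁)
            else lam * Real.exp η₁)
          + (∑ j ∈ (zeroSet k y)ᶜ, μ j) * Real.exp (-η₁)
          + (∑ i ∈ zeroSet k y, μ i)
            * if m = 0 then 1 else Real.exp (-η₀ + ((k : ℝ) - 1) * η₁))
        * Real.exp (η₀ * m + η₁ * ∑ i, (y i : ℝ)) := by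
  unfold jsqMean
  rw [add_mul, add_mul]
  refine congrArg₂ _ (congrArg₂ _ ?_ ?_) ?_
  · simp only
    split_ifs with h
    · obtain ⟨i, hi⟩ := Finset.card_eq_one.1 h
      have hzero : ∀ j, y j = 0 ↔ j = i := fun j => by
        rw [← mem_zeroSet, hi, Finset.mem_singleton]
      have hsum : ∑ j, ((y j - 1 : ℕ) : ℝ) = ∑ j, (y j : ℝ) - ((k : ℝ) - 1) := by
        have h1 : ∀ j, ((y j - 1 : ℕ) : ℝ) = (y j : ℝ) - 1 + if j = i then 1 else 0 := by
          intro j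
          split_ifs with hj
          · simp [(hzero j).2 hj]
          · have : 1 ≤ y j := Nat.one_le_iff_ne_zero.2 fun h => hj ((hzero j).1 h)
            push_cast [Nat.cast_sub this]
            ring
        simp only [h1, Finset.sum_add_distrib, Finset.sum_sub_distrib, Finset.sum_ite_eq',
          Finset.mem_univ, if_true, Finset.sum_const, Finset.card_univ, Fintype.card_fin,
          nsmul_eq_mul, mul_one]
        ring
      rw [hsum, mul_assoc, ← Real.exp_add]
      push_cast
      ring_nf
    · obtain ⟨i₀, hi₀⟩ := hy
      have hcard : ((zeroSet k y).card : ℝ) ≠ 0 :=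
        Nat.cast_ne_zero.2 (Finset.card_ne_zero_of_mem (mem_zeroSet.2 hi₀))
      have hterm : ∀ i ∈ zeroSet k y, lam / (zeroSet k y).card *
          Real.exp (η₀ * m + η₁ * ∑ j, (Function.update y i 1 j : ℝ))
          = lam / (zeroSet k y).card *
            (Real.exp η₁ * Real.exp (η₀ * m + η₁ * ∑ i, (y i : ℝ))) := by
        intro i hi
        rw [sum_update_natCast, mem_zeroSet.1 hi, ← Real.exp_add]
        push_cast
        ring_nf
      rw [Finset.sum_congr rfl hterm, Finset.sum_const, nsmul_eq_mul]
      field_simp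
  · simp only
    rw [mul_assoc, Finset.sum_mul]
    refine Finset.sum_congr rfl fun j hj => ?_
    have hj1 : 1 ≤ y j :=
      Nat.one_le_iff_ne_zero.2 fun h => Finset.mem_compl.1 hj (mem_zeroSet.2 h)
    rw [sum_update_natCast, ← Real.exp_add]
    push_cast [Nat.cast_sub hj1]
    ring_nf
  · rw [mul_assoc, Finset.sum_mul]
    refine Finset.sum_congr rfl fun i hi => ?_
    by_cases hm : m = 0
    · simp [hm]
    · have hsum : ∑ j, ((if j = i then 0 else y j + 1 : ℕ) : ℝ)
          = ∑ j, (y j : ℝ) + ((k : ℝ) - 1) := by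
        have h1 : ∀ j, ((if j = i then 0 else y j + 1 : ℕ) : ℝ)
            = (y j : ℝ) + 1 - if j = i then 1 else 0 := by
          intro j
          split_ifs with hj
          · simp [hj, mem_zeroSet.1 hi]
          · simp
        simp only [h1, Finset.sum_add_distrib, Finset.sum_sub_distrib, Finset.sum_ite_eq',
          Finset.mem_univ, if_true, Finset.sum_const, Finset.card_univ, Fintype.card_fin,
          nsmul_eq_mul, mul_one]
        ring
      simp only [hm, if_false]
      rw [hsum, ← Real.exp_add]
      push_cast [Nat.cast_sub (Nat.one_le_iff_ne_zero.2 hm)]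
      ring_nf

/-- At a point of the region `γ < 1`, finiteness of the generating function of `Y` alone gives
finiteness of the joint one. -/
theorem phi_lt_top_of_gamma2_lt_one {k : ℕ} {lam : ℝ} {μ : Fin k → ℝ} (hlam : 0 < lam)
    (hμ : ∀ i, 0 < μ i) (hnorm : lam + ∑ i, μ i = 1) {π : ℕ × (Fin k → ℕ) → ℝ}
    (hπnn : ∀ s, 0 ≤ π s) (hπsupp : ∀ s, π s ≠ 0 → ∃ i : Fin k, s.2 i = 0)
    (hπsum : HasSum π 1)
    (hπstat : ∀ s', (∑' s, π s * jsqP k lam μ s s') = π s') (η₀ η₁ : ℝ)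
    (hγ : ∀ U : Finset (Fin k), U.Nonempty → gamma2 k lam μ U η₀ η₁ < 1)
    (hφ : phi k π (Fin.cons 0 (fun _ => η₁)) < ⊤) :
    phi k π (Fin.cons η₀ (fun _ => η₁)) < ⊤ := by
  classical
  obtain ⟨r, hr, hγr⟩ : ∃ r < 1, ∀ U : Finset (Fin k), U.Nonempty →
      gamma2 k lam μ U η₀ η₁ ≤ r := by
    set g : Finset (Fin k) → ℝ := fun U => if U.Nonempty then gamma2 k lam μ U η₀ η₁ else 0
    obtain ⟨V, -, hV⟩ := Finset.exists_max_image Finset.univ g Finset.univ_nonempty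
    refine ⟨g V, ?_, fun U hU => ?_⟩
    · simp only [g]
      split_ifs with h
      · exact hγ V h
      · exact zero_lt_one
    · simpa [g, hU] using hV U (Finset.mem_univ _)
  rw [phi_cons] at hφ ⊢
  have hne : ∀ y : Fin k → ℕ, (∃ i, y i = 0) → (zeroSet k y).Nonempty :=
    fun y ⟨i, hi⟩ => ⟨i, mem_zeroSet.2 hi⟩
  refine lt_top_iff_ne_top.2 (jsq_tsum_ne_top_of_drift hlam hμ hnorm hπnn hπsupp hπsum hπstat
    (fun s => Real.exp (η₀ * s.1 + η₁ * ∑ i, (s.2 i : ℝ))) (fun s => (Real.exp_pos _).le)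
    {s | s.1 = 0} r 2 hr ?_ ?_ ?_)
  · rintro ⟨m, y⟩ hy hm
    have hm : m ≠ 0 := hm
    rw [jsqMean_exp η₀ η₁ m y hy, if_neg hm]
    exact mul_le_mul_of_nonneg_right (hγr _ (hne y hy)) (Real.exp_pos _).le
  · rintro ⟨m, y⟩ hy hm
    have hm : m = 0 := hm
    rw [jsqMean_exp η₀ η₁ m y hy, if_pos hm]
    refine mul_le_mul_of_nonneg_right ?_ (Real.exp_pos _).le
    have h1 := hγ _ (hne y hy)
    unfold gamma2 at h1
    have h2 : 0 ≤ (∑ i ∈ zeroSet k y, μ i) * Real.exp (-η₀ + ((k : ℝ) - 1) * η₁) :=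
      mul_nonneg (Finset.sum_nonneg fun i _ => (hμ i).le) (Real.exp_pos _).le
    have h3 : ∑ i ∈ zeroSet k y, μ i ≤ ∑ i, μ i :=
      Finset.sum_le_univ_sum_of_nonneg fun i => (hμ i).le
    linarith
  · refine ne_top_of_le_ne_top hφ.ne (ENNReal.tsum_le_tsum fun s => ?_)
    by_cases hs : s.1 = 0 <;> simp [hs]

/-- A finite joint exponential moment with nonnegative second argument controls the moments of
all queue lengths, hence widens the region of convergence. -/
theorem phi_lt_top_of_phi_lt_top {k : ℕ} {lam : ℝ} {μ : Fin k → ℝ} (hlam : 0 < lam)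
    (hμ : ∀ i, 0 < μ i) (hnorm : lam + ∑ i, μ i = 1) {π : ℕ × (Fin k → ℕ) → ℝ}
    (hπnn : ∀ s, 0 ≤ π s) (hπsupp : ∀ s, π s ≠ 0 → ∃ i : Fin k, s.2 i = 0)
    (hπsum : HasSum π 1)
    (hπstat : ∀ s', (∑' s, π s * jsqP k lam μ s s') = π s') {ζ₀ ζ₁ η₀ η₁ : ℝ}
    (hζ₀ : 0 < ζ₀) (hζ₁ : 0 ≤ ζ₁) (hφ : phi k π (Fin.cons ζ₀ (fun _ => ζ₁)) < ⊤)
    (hη₀ : η₀ ≤ ζ₀) (hη₁ : ((k : ℝ) - 1) * η₁ ≤ ζ₀) :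
    phi k π (Fin.cons η₀ (fun _ => η₁)) < ⊤ := by
  have hmin : ∑' s : ℕ × (Fin k → ℕ), ENNReal.ofReal (π s * Real.exp (ζ₀ * s.1)) ≠ ⊤ := by
    have h := (phi_cons_mono hπnn (le_refl ζ₀) hζ₁).trans_lt hφ
    rw [phi_cons] at h
    simpa using h.ne
  have hq := jsq_queue_moment_ne_top hlam hμ hnorm hπnn hπsupp hπsum hπstat ζ₀ hζ₀ hmin
  rw [phi_cons]
  refine lt_of_le_of_lt ?_ (lt_top_iff_ne_top.2 (ENNReal.sum_ne_top.2
    fun j (_ : j ∈ (Finset.univ : Finset (Fin k))) => hq j))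
  rw [← Summable.tsum_finsetSum fun _ _ => ENNReal.summable]
  refine ENNReal.tsum_le_tsum fun s => ?_
  by_cases hs : π s = 0
  · simp [hs]
  obtain ⟨i, hi⟩ := hπsupp s hs
  obtain ⟨j, -, hj⟩ := Finset.exists_max_image Finset.univ s.2 ⟨i, Finset.mem_univ i⟩
  refine le_trans ?_ (Finset.single_le_sum (fun _ _ => zero_le) (Finset.mem_univ j))
  refine ENNReal.ofReal_le_ofReal (mul_le_mul_of_nonneg_left (Real.exp_le_exp.2 ?_) (hπnn s))
  have hk : (1 : ℝ) ≤ k := by exact_mod_cast i.pos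
  have hsum : ∑ l, (s.2 l : ℝ) ≤ ((k : ℝ) - 1) * s.2 j := by
    rw [← Finset.add_sum_erase _ _ (Finset.mem_univ i), hi, Nat.cast_zero, zero_add]
    calc ∑ l ∈ Finset.univ.erase i, (s.2 l : ℝ)
        ≤ ∑ l ∈ Finset.univ.erase i, (s.2 j : ℝ) :=
          Finset.sum_le_sum fun l _ => Nat.cast_le.2 (hj l (Finset.mem_univ l))
      _ = ((k : ℝ) - 1) * s.2 j := by
          rw [Finset.sum_const, Finset.card_erase_of_mem (Finset.mem_univ i), nsmul_eq_mul,
            Finset.card_univ, Fintype.card_fin, Nat.cast_sub i.pos]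
          simp
  have hsum0 : 0 ≤ ∑ l, (s.2 l : ℝ) := Finset.sum_nonneg fun _ _ => Nat.cast_nonneg _
  have hM : η₀ * s.1 ≤ ζ₀ * s.1 := mul_le_mul_of_nonneg_right hη₀ (Nat.cast_nonneg _)
  have hY : η₁ * ∑ l, (s.2 l : ℝ) ≤ ζ₀ * s.2 j := by
    rcases le_total η₁ 0 with h | h
    · exact (mul_nonpos_of_nonpos_of_nonneg h hsum0).trans (by positivity)
    · calc η₁ * ∑ l, (s.2 l : ℝ) ≤ η₁ * (((k : ℝ) - 1) * s.2 j) :=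
            mul_le_mul_of_nonneg_left hsum h
        _ = (((k : ℝ) - 1) * η₁) * s.2 j := by ring
        _ ≤ ζ₀ * s.2 j := mul_le_mul_of_nonneg_right hη₁ (Nat.cast_nonneg _)
  push_cast
  linarith

theorem gamma2_total {k : ℕ} {lam : ℝ} {μ : Fin k → ℝ} (U : Finset (Fin k)) (η : ℝ) :
    gamma2 k lam μ U (k * η) η = lam * Real.exp η + (∑ i, μ i) * Real.exp (-η) := by
  have h1 : (k : ℝ) * η - ((k : ℝ) - 1) * η = η := by ring
  have h2 : -((k : ℝ) * η) + ((k : ℝ) - 1) * η = -η := by ring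
  unfold gamma2
  rw [h1, h2, ite_self, ← Finset.sum_add_sum_compl U μ]
  ring

/-- Along the direction counting the customers in the system the region `γ < 1` is entered. -/
theorem exists_gamma2_lt_one {k : ℕ} {lam : ℝ} {μ : Fin k → ℝ} (hlam : 0 < lam)
    (hnorm : lam + ∑ i, μ i = 1) (hlt : lam < ∑ i, μ i) {t : ℝ} (ht : 0 < t) :
    ∃ η, 0 < η ∧ η ≤ t ∧ ∀ U : Finset (Fin k), gamma2 k lam μ U (k * η) η < 1 := by
  set σ := ∑ i, μ i
  have hσ : 0 < σ := hlam.trans hlt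
  set x := min t (Real.log (σ / lam) / 2)
  have hlog : 0 < Real.log (σ / lam) := Real.log_pos ((one_lt_div hlam).2 hlt)
  have hx : 0 < x := lt_min ht (by linarith)
  refine ⟨x, hx, min_le_left _ _, fun U => ?_⟩
  rw [gamma2_total]
  have hx' : x < Real.log (σ / lam) := (min_le_right _ _).trans_lt (by linarith)
  have h1 : 1 < Real.exp x := Real.one_lt_exp_iff.2 hx
  have h2 : Real.exp x * lam < σ := by
    have := Real.exp_lt_exp.2 hx'
    rwa [Real.exp_log (by positivity), lt_div_iff₀ hlam] at this
  have h3 : Real.exp x * Real.exp (-x) = 1 := by rw [← Real.exp_add]; simp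
  have h4 : 0 < Real.exp (-x) := Real.exp_pos _
  have key : (lam * Real.exp x + σ * Real.exp (-x)) - 1
      = Real.exp (-x) * ((Real.exp x - 1) * (Real.exp x * lam - σ)) := by
    linear_combination (-(lam * Real.exp x) + lam + σ) * h3 + hnorm
  have := mul_neg_of_pos_of_neg h4
    (mul_neg_of_pos_of_neg (sub_pos.2 h1) (sub_neg.2 h2))
  linarith

theorem le_of_gamma2_lt_one {k : ℕ} {lam : ℝ} {μ : Fin k → ℝ} (hlam : 0 < lam)
    (hμ : ∀ i, 0 < μ i) (i : Fin k) {η₀ η₁ t : ℝ} (h : gamma2 k lam μ {i} η₀ η₁ < 1)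
    (hη₁ : η₁ ≤ t) : η₀ ≤ ((k : ℝ) - 1) * t - Real.log lam := by
  have hk : (1 : ℝ) ≤ k := by exact_mod_cast i.pos
  unfold gamma2 at h
  rw [if_pos (Finset.card_singleton i)] at h
  have h2 : 0 ≤ (∑ j ∈ ({i} : Finset (Fin k))ᶜ, μ j) * Real.exp (-η₁) :=
    mul_nonneg (Finset.sum_nonneg fun i _ => (hμ i).le) (Real.exp_pos _).le
  have h3 : 0 ≤ (∑ j ∈ ({i} : Finset (Fin k)), μ j) * Real.exp (-η₀ + ((k : ℝ) - 1) * η₁) :=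
    mul_nonneg (Finset.sum_nonneg fun i _ => (hμ i).le) (Real.exp_pos _).le
  have h4 : lam * Real.exp (η₀ - ((k : ℝ) - 1) * η₁) < 1 := by linarith
  have h5 := Real.log_neg (by positivity) h4
  rw [Real.log_mul hlam.ne' (Real.exp_pos _).ne', Real.log_exp] at h5
  have h6 : ((k : ℝ) - 1) * η₁ ≤ ((k : ℝ) - 1) * t :=
    mul_le_mul_of_nonneg_left hη₁ (by linarith)
  linarith

/-- A point of the region `γ < 1` with negative second coordinate may be moved up to the axis. -/
theorem gamma2_zero_lt_one {k : ℕ} {lam : ℝ} {μ : Fin k → ℝ} (hlam : 0 < lam)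
    (hμ : ∀ i, 0 < μ i) (hnorm : lam + ∑ i, μ i = 1) {η₀ η₁ : ℝ} (hη₀ : 0 < η₀)
    (hη₁ : η₁ ≤ 0) (U : Finset (Fin k)) (hU : U.Nonempty)
    (h : gamma2 k lam μ U η₀ η₁ < 1) : gamma2 k lam μ U η₀ 0 < 1 := by
  have hk : (1 : ℝ) ≤ k := by
    obtain ⟨i, -⟩ := hU
    exact_mod_cast i.pos
  have hsplit := Finset.sum_add_sum_compl U μ
  have hUpos : 0 < ∑ i ∈ U, μ i := Finset.sum_pos (fun i _ => hμ i) hU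
  have hcpos : 0 ≤ ∑ i ∈ Uᶜ, μ i := Finset.sum_nonneg fun i _ => (hμ i).le
  have he : Real.exp (-η₀) < 1 := Real.exp_lt_one_iff.mpr (by linarith)
  unfold gamma2 at h ⊢
  simp only [mul_zero, sub_zero, neg_zero, add_zero, Real.exp_zero, mul_one] at h ⊢
  split_ifs at h ⊢ with hc
  · set p := ∑ i ∈ U, μ i
    set q := ∑ i ∈ Uᶜ, μ i
    set v := η₀ - ((k : ℝ) - 1) * η₁ with hv
    have hvη : η₀ ≤ v := by
      have := mul_nonpos_of_nonneg_of_nonpos (sub_nonneg.2 hk) hη₁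
      linarith
    have e1 : -η₀ + ((k : ℝ) - 1) * η₁ = -v := by rw [hv]; ring
    rw [e1] at h
    have h1 : 1 ≤ Real.exp (-η₁) := Real.one_le_exp (by linarith)
    have h2 : lam * Real.exp v + p * Real.exp (-v) < lam + p := by
      have := mul_le_mul_of_nonneg_left h1 hcpos
      linarith
    have factor : ∀ x : ℝ, lam * Real.exp x + p * Real.exp (-x) - (lam + p)
        = Real.exp (-x) * ((Real.exp x - 1) * (lam * Real.exp x - p)) := fun x => by
      have h3 : Real.exp x * Real.exp (-x) = 1 := by rw [← Real.exp_add]; simp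
      linear_combination (-(lam * Real.exp x) + lam + p) * h3
    have hv1 : 0 < Real.exp v - 1 := sub_pos.2 (Real.one_lt_exp_iff.2 (hη₀.trans_le hvη))
    have hη1 : 0 < Real.exp η₀ - 1 := sub_pos.2 (Real.one_lt_exp_iff.2 hη₀)
    have h4 : lam * Real.exp v - p < 0 := by
      by_contra! hge
      have := mul_nonneg (Real.exp_pos (-v)).le (mul_nonneg hv1.le hge)
      rw [← factor v] at this
      linarith
    have h5 : lam * Real.exp η₀ - p < 0 := by
      have := mul_le_mul_of_nonneg_left (Real.exp_le_exp.2 hvη) hlam.le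
      linarith
    have h6 := mul_neg_of_pos_of_neg (Real.exp_pos (-η₀)) (mul_neg_of_pos_of_neg hη1 h5)
    rw [← factor η₀] at h6
    linarith
  · have := mul_lt_mul_of_pos_left he hUpos
    linarith

theorem continuous_gamma2 (k : ℕ) (lam : ℝ) (μ : Fin k → ℝ) (U : Finset (Fin k)) (η₀ : ℝ) :
    Continuous fun η₁ => gamma2 k lam μ U η₀ η₁ := by
  unfold gamma2
  split_ifs <;> fun_prop

/-- A point of the region `γ < 1` below height `t > 0` may be moved into the strip `[0, t)`. -/
theorem exists_gamma2_lt_one_mem_Ico {k : ℕ} {lam : ℝ} {μ : Fin k → ℝ} (hlam : 0 < lam)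
    (hμ : ∀ i, 0 < μ i) (hnorm : lam + ∑ i, μ i = 1) {η₀ η₁ t : ℝ} (hη₀ : 0 < η₀)
    (ht : 0 < t) (hη₁ : η₁ ≤ t)
    (h : ∀ U : Finset (Fin k), U.Nonempty → gamma2 k lam μ U η₀ η₁ < 1) :
    ∃ ζ, 0 ≤ ζ ∧ ζ < t ∧ ∀ U : Finset (Fin k), U.Nonempty → gamma2 k lam μ U η₀ ζ < 1 := by
  rcases le_or_gt η₁ 0 with h0 | h0
  · exact ⟨0, le_rfl, ht, fun U hU =>
      gamma2_zero_lt_one hlam hμ hnorm hη₀ h0 U hU (h U hU)⟩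
  · have hev : ∀ᶠ ζ in 𝓝[<] η₁, ∀ U : Finset (Fin k), U.Nonempty →
        gamma2 k lam μ U η₀ ζ < 1 := by
      refine Filter.eventually_all.2 fun U => ?_
      by_cases hU : U.Nonempty
      · refine Filter.Eventually.filter_mono nhdsWithin_le_nhds ?_
        filter_upwards [(continuous_gamma2 k lam μ U η₀).continuousAt.eventually_lt
          continuousAt_const (h U hU)] with ζ hζ _ using hζ
      · exact Filter.Eventually.of_forall fun ζ h => absurd h hU
    obtain ⟨ζ, hζ, hζ'⟩ := (hev.and (Ioo_mem_nhdsLT h0)).exists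
    exact ⟨ζ, hζ'.1.le, hζ'.2.trans_le hη₁, hζ⟩

/-- One step of the iteration: convergence on `{0} × (-∞, t)` extends to
`(-∞, a) × (-∞, a / (k - 1))`. -/
theorem jsq_expand_step {k : ℕ} (hk : 2 ≤ k) {lam : ℝ} {μ : Fin k → ℝ} (hlam : 0 < lam)
    (hμ : ∀ i, 0 < μ i) (hnorm : lam + ∑ i, μ i = 1) (hlt : lam < ∑ i, μ i)
    {π : ℕ × (Fin k → ℕ) → ℝ}
    (hπnn : ∀ s, 0 ≤ π s) (hπsupp : ∀ s, π s ≠ 0 → ∃ i : Fin k, s.2 i = 0)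
    (hπsum : HasSum π 1)
    (hπstat : ∀ s', (∑' s, π s * jsqP k lam μ s s') = π s') {t a : ℝ} (ht : 0 < t)
    (ha : a = sSup {η₀ : ℝ | ∃ η₁ ≤ t,
      ∀ U : Finset (Fin k), U.Nonempty → gamma2 k lam μ U η₀ η₁ < 1})
    (hφ : ∀ η₁ < t, phi k π (Fin.cons 0 (fun _ => η₁)) < ⊤) :
    0 < a ∧ ∀ η₀ < a, ∀ η₁ < a / ((k : ℝ) - 1), phi k π (Fin.cons η₀ (fun _ => η₁)) < ⊤ := by
  have hk' : (2 : ℝ) ≤ k := by exact_mod_cast hk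
  set A := {η₀ : ℝ | ∃ η₁ ≤ t,
    ∀ U : Finset (Fin k), U.Nonempty → gamma2 k lam μ U η₀ η₁ < 1}
  have hbdd : BddAbove A := by
    refine ⟨((k : ℝ) - 1) * t - Real.log lam, ?_⟩
    rintro x ⟨z, hz, h⟩
    exact le_of_gamma2_lt_one hlam hμ ⟨0, by omega⟩ (h _ (Finset.singleton_nonempty _)) hz
  obtain ⟨η, hη, hηt, hγ⟩ := exists_gamma2_lt_one hlam hnorm hlt ht
  have hmem : (k : ℝ) * η ∈ A := ⟨η, hηt, fun U _ => hγ U⟩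
  have hapos : 0 < a := by
    rw [ha]
    exact lt_of_lt_of_le (by positivity) (le_csSup hbdd hmem)
  refine ⟨hapos, fun η₀ hη₀ η₁ hη₁ => ?_⟩
  have hk1 : (0 : ℝ) < (k : ℝ) - 1 := by linarith
  rw [lt_div_iff₀ hk1] at hη₁
  have hmax : max (max η₀ 0) (((k : ℝ) - 1) * η₁) < a :=
    max_lt (max_lt hη₀ hapos) (by linarith)
  rw [ha] at hmax
  obtain ⟨ζ₀, ⟨z, hz, hζ⟩, hlt'⟩ := exists_lt_of_lt_csSup ⟨_, hmem⟩ hmax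
  obtain ⟨h12, h3⟩ := max_lt_iff.1 hlt'
  obtain ⟨h1, h2⟩ := max_lt_iff.1 h12
  obtain ⟨ζ₁, hζ₁, hζ₁t, hζγ⟩ := exists_gamma2_lt_one_mem_Ico hlam hμ hnorm h2 ht hz hζ
  exact phi_lt_top_of_phi_lt_top hlam hμ hnorm hπnn hπsupp hπsum hπstat h2 hζ₁
    (phi_lt_top_of_gamma2_lt_one hlam hμ hnorm hπnn hπsupp hπsum hπstat ζ₀ ζ₁ hζγ
      (hφ ζ₁ hζ₁t)) h1.le h3.le

/-- **Expansion of the confirmed convergence region by iteration:** starting from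
`φ(0, ε𝟙) < ∞` and iterating `a_{ℓ+1} = sup{η₀ : ∃ η₁ ≤ t_ℓ, γ^{(2)}_{+U}(η₀,η₁) < 1 ∀U}`,
`t_{ℓ+1} = a_{ℓ+1}/(k−1)`, every `(η₀, η₁)` below the limits `(a_∞, t_∞)` satisfies
`φ(η₀, η₁𝟙) < ∞`. -/
theorem jsq_expand_domain
    (k : ℕ) (hk : 2 ≤ k) (lam : ℝ) (μ : Fin k → ℝ)
    (hlam : 0 < lam) (hμ : ∀ i, 0 < μ i)
    (hnorm : lam + ∑ i, μ i = 1)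
    (hρ : rho k lam μ < 1)
    (π : ℕ × (Fin k → ℕ) → ℝ)
    (hπnn : ∀ s, 0 ≤ π s)
    (hπsupp : ∀ s, π s ≠ 0 → ∃ i : Fin k, s.2 i = 0)
    (hπsum : HasSum π 1)
    (hπstat : ∀ s', (∑' s, π s * jsqP k lam μ s s') = π s')
    (ε : ℝ) (hε : 0 < ε)
    (hεγ : ∀ U : Finset (Fin k), U.card = 1 → gamma2 k lam μ U 0 ε < 1)
    (hφε : phi k π (Fin.cons 0 (fun _ => ε)) < ⊤)
    (a t : ℕ → ℝ)
    (ht0 : t 0 = ε)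
    (ha : ∀ ℓ : ℕ, a (ℓ + 1) = sSup {η₀ : ℝ | ∃ η₁ ≤ t ℓ,
      ∀ U : Finset (Fin k), U.Nonempty → gamma2 k lam μ U η₀ η₁ < 1})
    (ht : ∀ ℓ : ℕ, t (ℓ + 1) = a (ℓ + 1) / ((k : ℝ) - 1))
    (aLim tLim : ℝ)
    (hlima : Tendsto a atTop (𝓝 aLim))
    (hlimt : Tendsto t atTop (𝓝 tLim))
    (η₀ η₁ : ℝ) (hη₀ : η₀ < aLim) (hη₁ : η₁ < tLim) :
    phi k π (Fin.cons η₀ (fun _ => η₁)) < ⊤ := by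
  have hlt : lam < ∑ i, μ i := by
    have hσ : 0 < ∑ i, μ i :=
      Finset.sum_pos (fun i _ => hμ i) ⟨⟨0, by omega⟩, Finset.mem_univ _⟩
    exact (div_lt_one hσ).1 hρ
  have hk1 : (0 : ℝ) < (k : ℝ) - 1 := by
    have : (2 : ℝ) ≤ k := by exact_mod_cast hk
    linarith
  have step : ∀ ℓ, 0 < t ℓ → (∀ z < t ℓ, phi k π (Fin.cons 0 (fun _ => z)) < ⊤) →
      0 < a (ℓ + 1) ∧ ∀ x < a (ℓ + 1), ∀ z < t (ℓ + 1),
        phi k π (Fin.cons x (fun _ => z)) < ⊤ := fun ℓ htℓ hℓ => by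
    rw [ht ℓ]
    exact jsq_expand_step hk hlam hμ hnorm hlt hπnn hπsupp hπsum hπstat htℓ (ha ℓ) hℓ
  have main : ∀ ℓ, 0 < t ℓ ∧ ∀ z < t ℓ, phi k π (Fin.cons 0 (fun _ => z)) < ⊤ := by
    intro ℓ
    induction ℓ with
    | zero =>
      rw [ht0]
      exact ⟨hε, fun z hz => (phi_cons_mono hπnn le_rfl hz.le).trans_lt hφε⟩
    | succ ℓ ih =>
      obtain ⟨hpos, hall⟩ := step ℓ ih.1 ih.2
      refine ⟨?_, hall 0 hpos⟩
      rw [ht ℓ]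
      exact div_pos hpos hk1
  obtain ⟨ℓ, ⟨h₀, h₁⟩, hℓ⟩ := (((hlima.eventually_const_lt hη₀).and
    (hlimt.eventually_const_lt hη₁)).and (eventually_ge_atTop 1)).exists
  obtain ⟨n, rfl⟩ : ∃ n, ℓ = n + 1 := ⟨ℓ - 1, by omega⟩
  exact (step n (main n).1 (main n).2).2 η₀ h₀ η₁ h₁
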